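/- For every natural number n ≥ 1, the function F_n(t) = Σ_{k=0}^{n} (C(n,k) t^k (1-t)^{n-k})² is convex on [0,1] if and only if P_n'(x)/P_n(x) ≤ 2n²/(x + (2n-1)√(x²-1)) for all x ≥ 1, where P_n is the n-th Legendre polynomial. -/

import Mathlib

/-- The sum of the squared Bernstein basis polynomials:
`F_n(t) = ∑_{k=0}^{n} (C(n,k) t^k (1-t)^{n-k})²`. -/
noncomputable def bernsteinSqSum (n : ℕ) (t : ℝ) : ℝ :=
  ∑ k ∈ Finset.range (n + 1), ((n.choose k : ℝ) * t ^ k * (1 - t) ^ (n - k)) ^ 2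

/-- The `n`-th Legendre polynomial, via Rodrigues' formula
`P_n(x) = (1/(2^n n!)) dⁿ/dxⁿ (x²-1)ⁿ`. -/
noncomputable def legendreP (n : ℕ) : ℝ → ℝ := fun x =>
  (1 / (2 ^ n * (n.factorial : ℝ))) * iteratedDeriv n (fun y => (y ^ 2 - 1) ^ n) x

open Polynomial in
theorem Polynomial.convexOn_Icc_iff_eval_derivative_derivative_nonneg (q : ℝ[X]) {a b : ℝ}
    (hab : a < b) :
    ConvexOn ℝ (Set.Icc a b) (fun t => q.eval t) ↔
      ∀ t ∈ Set.Icc a b, 0 ≤ (derivative (derivative q)).eval t := by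
  have h1 : deriv (fun t => q.eval t) = fun t => (derivative q).eval t := by
    ext t; exact q.deriv
  constructor
  · intro h t ht
    have hm := h.monotoneOn_deriv fun x _ => q.differentiableAt
    rw [h1] at hm
    have h2 := hm.derivWithin_nonneg (x := t)
    rwa [Polynomial.derivWithin _ (uniqueDiffOn_Icc hab t ht)] at h2
  · intro h
    refine convexOn_of_deriv2_nonneg' (convex_Icc a b) q.differentiableOn ?_ fun t ht => ?_
    · rw [h1]; exact (derivative q).differentiableOn
    · rw [Function.iterate_succ_apply, Function.iterate_one, h1, Polynomial.deriv]
      exact h t ht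

open Polynomial in
theorem Polynomial.iteratedDeriv_eval (p : ℝ[X]) (n : ℕ) :
    iteratedDeriv n (fun x => p.eval x) = fun x => (derivative^[n] p).eval x := by
  induction n with
  | zero => simp
  | succ n ih =>
    rw [iteratedDeriv_succ, ih, Function.iterate_succ_apply']
    ext x
    exact Polynomial.deriv _

open Polynomial in
/-- The `n`-th Legendre polynomial as an element of `ℝ[X]`. -/
noncomputable def legendrePoly (n : ℕ) : ℝ[X] :=
  C (1 / (2 ^ n * (n.factorial : ℝ))) * derivative^[n] ((X ^ 2 - 1) ^ n)

theorem legendreP_eq_eval (n : ℕ) : legendreP n = fun x => (legendrePoly n).eval x := by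
  have h : (fun y : ℝ => (y ^ 2 - 1) ^ n) =
      fun y => Polynomial.eval y ((Polynomial.X ^ 2 - 1) ^ n) := by
    ext y; simp
  ext x
  simp only [legendreP, legendrePoly, h, Polynomial.iteratedDeriv_eval, Polynomial.eval_mul,
    Polynomial.eval_C]

open Polynomial in
theorem iterate_derivative_X_sq_sub_one_pow_ode (n k : ℕ) :
    ((X : ℝ[X]) ^ 2 - 1) * derivative^[k + 2] ((X ^ 2 - 1) ^ n) +
        C (2 * (k + 1) : ℝ) * X * derivative^[k + 1] ((X ^ 2 - 1) ^ n) +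
        C (k * (k + 1) : ℝ) * derivative^[k] ((X ^ 2 - 1) ^ n) =
      C (2 * n : ℝ) * X * derivative^[k + 1] ((X ^ 2 - 1) ^ n) +
        C (2 * n * (k + 1) : ℝ) * derivative^[k] ((X ^ 2 - 1) ^ n) := by
  induction k with
  | zero =>
    have h : ((X : ℝ[X]) ^ 2 - 1) * derivative ((X ^ 2 - 1) ^ n) =
        C (2 * n : ℝ) * X * (X ^ 2 - 1) ^ n := by
      cases n with
      | zero => simp
      | succ m =>
        have h2 : (C 2 : ℝ[X]) = 2 := rfl
        rw [derivative_pow_succ]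
        simp [h2]
        ring
    have h' := congrArg derivative h
    simp only [derivative_mul, derivative_sub, derivative_X_pow, derivative_one, derivative_C,
      derivative_X] at h'
    simp only [Function.iterate_succ_apply, Function.iterate_zero, id] at h' ⊢
    simp at h' ⊢
    linear_combination h'
  | succ k ih =>
    have h' := congrArg derivative ih
    simp only [derivative_mul, derivative_sub, derivative_add, derivative_X_pow, derivative_one,
      derivative_C, derivative_X, ← Function.iterate_succ_apply' derivative] at h'
    have h2 : (C 2 : ℝ[X]) = 2 := rfl
    simp [h2] at h' ⊢
    linear_combination h'

open Polynomial in
theorem legendrePoly_ode (n : ℕ) (x : ℝ) :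
    (x ^ 2 - 1) * (derivative (derivative (legendrePoly n))).eval x +
        2 * x * (derivative (legendrePoly n)).eval x =
      n * (n + 1) * (legendrePoly n).eval x := by
  have h := congrArg (eval x) (iterate_derivative_X_sq_sub_one_pow_ode n n)
  simp only [legendrePoly, derivative_C_mul, ← Function.iterate_succ_apply' derivative]
  simp only [eval_add, eval_mul, eval_sub, eval_pow, eval_X, eval_one, eval_C] at h ⊢
  linear_combination (1 / (2 ^ n * (n.factorial : ℝ))) * h

theorem legendrePoly_eval (n : ℕ) (x : ℝ) :
    (legendrePoly n).eval x =
      1 / 2 ^ n * ∑ k ∈ Finset.range (n + 1),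
        (n.choose k : ℝ) ^ 2 * (x - 1) ^ k * (x + 1) ^ (n - k) := by
  have h : ((Polynomial.X : Polynomial ℝ) ^ 2 - 1) ^ n =
      (Polynomial.X - Polynomial.C 1) ^ n * (Polynomial.X + Polynomial.C 1) ^ n := by
    rw [← mul_pow, Polynomial.C_1]; ring
  simp only [legendrePoly, h, Polynomial.iterate_derivative_mul,
    Polynomial.iterate_derivative_X_sub_pow, Polynomial.iterate_derivative_X_add_pow,
    Polynomial.eval_mul, Polynomial.eval_C, Polynomial.eval_finsetSum, Finset.mul_sum]
  refine Finset.sum_congr rfl fun k hk => ?_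
  have hk : k ≤ n := Finset.mem_range_succ_iff.mp hk
  have h1 : (n.descFactorial k : ℝ) * n.descFactorial (n - k) =
      n.factorial * n.choose k := by
    rw [Nat.descFactorial_eq_factorial_mul_choose, Nat.descFactorial_eq_factorial_mul_choose,
      Nat.choose_symm hk, ← Nat.choose_mul_factorial_mul_factorial hk]
    push_cast
    ring
  have hn : (n.factorial : ℝ) ≠ 0 := by positivity
  simp only [Polynomial.eval_mul, Polynomial.eval_pow, Polynomial.eval_sub,
    Polynomial.eval_add, Polynomial.eval_X, Polynomial.eval_C, nsmul_eq_mul, Polynomial.eval_natCast, Nat.sub_sub_self hk]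
  field_simp
  linear_combination (n.choose k : ℝ) * (x - 1) ^ k * (x + 1) ^ (n - k) * h1

theorem legendrePoly_eval_pos (n : ℕ) {x : ℝ} (hx : 1 ≤ x) : 0 < (legendrePoly n).eval x := by
  rw [legendrePoly_eval]
  have hx' : 0 ≤ x - 1 := by linarith
  refine mul_pos (by positivity) (Finset.sum_pos' (fun k _ => by positivity) ⟨0, by simp, ?_⟩)
  simp only [pow_zero, Nat.choose_zero_right]
  positivity

open Polynomial in
/-- `bernsteinSqSum n` as an element of `ℝ[X]`. -/
noncomputable def bernsteinSqSumPoly (n : ℕ) : ℝ[X] :=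
  ∑ k ∈ Finset.range (n + 1), (C (n.choose k : ℝ) * X ^ k * (1 - X) ^ (n - k)) ^ 2

theorem bernsteinSqSum_eq_eval (n : ℕ) :
    bernsteinSqSum n = fun t => (bernsteinSqSumPoly n).eval t := by
  ext t
  simp [bernsteinSqSum, bernsteinSqSumPoly, Polynomial.eval_finsetSum]

open Polynomial in
theorem bernsteinSqSumPoly_comp_one_sub_X (n : ℕ) :
    (bernsteinSqSumPoly n).comp (1 - X) = bernsteinSqSumPoly n := by
  rw [bernsteinSqSumPoly, ← coe_compRingHom_apply, map_sum]
  conv_rhs => rw [← Finset.sum_range_reflect]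
  refine Finset.sum_congr rfl fun k hk => ?_
  have hk : k ≤ n := Finset.mem_range_succ_iff.mp hk
  have h1 : n + 1 - 1 - k = n - k := by omega
  rw [coe_compRingHom_apply, h1, Nat.choose_symm hk, Nat.sub_sub_self hk]
  simp
  ring

open Polynomial in
theorem bernsteinSqSumPoly_derivative_derivative_eval_one_sub (n : ℕ) (t : ℝ) :
    (derivative (derivative (bernsteinSqSumPoly n))).eval (1 - t) =
      (derivative (derivative (bernsteinSqSumPoly n))).eval t := by
  conv_rhs => rw [← bernsteinSqSumPoly_comp_one_sub_X]
  simp [derivative_comp]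

theorem bernsteinSqSumPoly_eval_one_sub_div_two (n : ℕ) {s : ℝ} (hs : s ≠ 0) :
    (bernsteinSqSumPoly n).eval ((1 - s) / 2) =
      s ^ n * (legendrePoly n).eval ((s + s⁻¹) / 2) := by
  rw [legendrePoly_eval, bernsteinSqSumPoly, Polynomial.eval_finsetSum, Finset.mul_sum,
    Finset.mul_sum]
  refine Finset.sum_congr rfl fun k hk => ?_
  obtain ⟨m, rfl⟩ := Nat.exists_eq_add_of_le (Finset.mem_range_succ_iff.mp hk)
  have h1 : (s + s⁻¹) / 2 - 1 = 2 / s * ((1 - s) / 2) ^ 2 := by field_simp; ring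
  have h2 : (s + s⁻¹) / 2 + 1 = 2 / s * (1 - (1 - s) / 2) ^ 2 := by field_simp; ring
  simp only [Polynomial.eval_mul, Polynomial.eval_pow, Polynomial.eval_sub, Polynomial.eval_X,
    Polynomial.eval_C, Polynomial.eval_one, h1, h2, Nat.add_sub_cancel_left]
  generalize 1 - (1 - s) / 2 = v
  generalize (1 - s) / 2 = u
  simp only [mul_pow, div_pow, pow_add]
  field_simp
  ring

open Polynomial in
theorem bernsteinSqSumPoly_derivative_derivative_eval (n : ℕ) {s : ℝ} (hs : 0 < s) :
    s ^ 2 * (derivative (derivative (bernsteinSqSumPoly n))).eval ((1 - s) / 2) =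
      4 * s ^ n * (2 * n ^ 2 * (legendrePoly n).eval ((s + s⁻¹) / 2) -
        (derivative (legendrePoly n)).eval ((s + s⁻¹) / 2) * (n * (s⁻¹ - s) + s)) := by
  set p := legendrePoly n
  set q := bernsteinSqSumPoly n
  have hL (r : ℝ[X]) (s : ℝ) : HasDerivAt (fun s : ℝ => r.eval ((1 - s) / 2))
      ((derivative r).eval ((1 - s) / 2) * (-1 / 2)) s :=
    (r.hasDerivAt _).comp s (((hasDerivAt_id s).const_sub 1).div_const 2)
  have hx {s : ℝ} (hs : 0 < s) (r : ℝ[X]) : HasDerivAt (fun s : ℝ => r.eval ((s + s⁻¹) / 2))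
      ((derivative r).eval ((s + s⁻¹) / 2) * ((1 + -(s ^ 2)⁻¹) / 2)) s :=
    (r.hasDerivAt _).comp s (((hasDerivAt_id s).add (hasDerivAt_inv hs.ne')).div_const 2)
  have hpow {s : ℝ} (hs : 0 < s) : HasDerivAt (fun s : ℝ => s ^ n) (s ^ n * (n * s⁻¹)) s := by
    refine (hasDerivAt_pow n s).congr_deriv ?_
    cases n with
    | zero => simp
    | succ m => rw [pow_succ]; field_simp; simp
  have h1 {s : ℝ} (hs : 0 < s) : (derivative q).eval ((1 - s) / 2) * (-1 / 2) =
      s ^ n * (n * s⁻¹) * p.eval ((s + s⁻¹) / 2) +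
        s ^ n * ((derivative p).eval ((s + s⁻¹) / 2) * ((1 + -(s ^ 2)⁻¹) / 2)) := by
    refine (hL q s).unique (((hpow hs).mul (hx hs p)).congr_of_eventuallyEq ?_)
    filter_upwards [lt_mem_nhds hs] with u hu
    exact bernsteinSqSumPoly_eval_one_sub_div_two n hu.ne'
  have hinv := hasDerivAt_inv hs.ne'
  have hsq : HasDerivAt (fun s : ℝ => (1 + -(s ^ 2)⁻¹) / 2) (s⁻¹ ^ 3) s := by
    refine ((((hasDerivAt_pow 2 s).fun_inv (by positivity)).fun_neg.const_add 1).div_const 2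
      ).congr_deriv ?_
    field_simp
    norm_num [mul_comm]
  have h2 := ((hL (derivative q) s).mul_const (-1 / 2)).unique
    (((((hpow hs).mul (hinv.const_mul (n : ℝ))).mul (hx hs p)).add
      ((hpow hs).mul ((hx hs (derivative p)).mul hsq))).congr_of_eventuallyEq (by
        filter_upwards [lt_mem_nhds hs] with u hu
        exact h1 hu))
  have hode := legendrePoly_ode n ((s + s⁻¹) / 2)
  simp only [Pi.mul_apply] at h2
  change _ = (n : ℝ) * (n + 1) * p.eval _ at hode
  generalize eval ((s + s⁻¹) / 2) (derivative (derivative p)) = P2 at *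
  generalize eval ((s + s⁻¹) / 2) (derivative p) = P1 at *
  generalize eval ((s + s⁻¹) / 2) p = P0 at *
  generalize eval ((1 - s) / 2) (derivative (derivative q)) = Q2 at *
  have hy : s * s⁻¹ = 1 := mul_inv_cancel₀ hs.ne'
  rw [← inv_pow] at h2
  generalize s ^ n = S at *
  generalize s⁻¹ = y at *
  have hy2 : s ^ 2 * y ^ 2 = 1 := by rw [← mul_pow, hy, one_pow]
  linear_combination 4 * s ^ 2 * h2 + 4 * S * hode +
    4 * S * ((n ^ 2 - n) * P0 - P2 / 2) * hy2 + 4 * S * n * P1 * s * hy +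
    4 * S * (1 - n) * P1 * y * hy2 + S * P2 * y ^ 2 * hy2 - 2 * S * P2 * hy

theorem one_le_half_add_inv {s : ℝ} (hs : 0 < s) : 1 ≤ (s + s⁻¹) / 2 := by
  have h : (s + s⁻¹) / 2 - 1 = (1 - s) ^ 2 / (2 * s) := by field_simp; ring
  have : 0 ≤ (1 - s) ^ 2 / (2 * s) := by positivity
  linarith

theorem legendre_bound_iff (n : ℕ) {s : ℝ} (hs : 0 < s) (hs1 : s ≤ 1) :
    let x := (s + s⁻¹) / 2
    deriv (legendreP n) x / legendreP n x ≤
          2 * (n : ℝ) ^ 2 / (x + (2 * (n : ℝ) - 1) * Real.sqrt (x ^ 2 - 1)) ↔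
      0 ≤ (bernsteinSqSumPoly n).derivative.derivative.eval ((1 - s) / 2) := by
  intro x
  have hinv : 1 ≤ s⁻¹ := (one_le_inv₀ hs).mpr hs1
  have hx : 1 ≤ x := one_le_half_add_inv hs
  have hsqrt : Real.sqrt (x ^ 2 - 1) = (s⁻¹ - s) / 2 := by
    rw [← Real.sqrt_sq (show 0 ≤ (s⁻¹ - s) / 2 by linarith)]
    congr 1
    simp only [x]; field_simp; ring
  have hden : x + (2 * (n : ℝ) - 1) * Real.sqrt (x ^ 2 - 1) = n * (s⁻¹ - s) + s := by
    rw [hsqrt]; simp only [x]; ring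
  have hden_pos : 0 < n * (s⁻¹ - s) + s := by
    have : 0 ≤ n * (s⁻¹ - s) := mul_nonneg n.cast_nonneg (by linarith)
    linarith
  have key := bernsteinSqSumPoly_derivative_derivative_eval n hs
  rw [hden, legendreP_eq_eval, Polynomial.deriv,
    div_le_div_iff₀ (legendrePoly_eval_pos n hx) hden_pos, ← sub_nonneg,
    ← mul_nonneg_iff_of_pos_left (show 0 < 4 * s ^ n by positivity), ← key,
    mul_nonneg_iff_of_pos_left (by positivity)]

theorem exists_eq_half_add_inv {x : ℝ} (hx : 1 ≤ x) :
    ∃ s : ℝ, 0 < s ∧ s ≤ 1 ∧ (s + s⁻¹) / 2 = x := by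
  have hsq : Real.sqrt (x ^ 2 - 1) ^ 2 = x ^ 2 - 1 := Real.sq_sqrt (by nlinarith)
  have hr := Real.sqrt_nonneg (x ^ 2 - 1)
  set r := Real.sqrt (x ^ 2 - 1)
  have hmul : (x + r) * (x - r) = 1 := by linear_combination -hsq
  refine ⟨(x + r)⁻¹, by positivity, inv_le_one_of_one_le₀ (by linarith), ?_⟩
  rw [inv_inv, inv_eq_of_mul_eq_one_right hmul]
  ring

theorem rasa_equiv_legendre_bound (n : ℕ) (hn : 1 ≤ n) :
    ConvexOn ℝ (Set.Icc (0 : ℝ) 1) (bernsteinSqSum n) ↔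
      ∀ x : ℝ, 1 ≤ x →
        deriv (legendreP n) x / legendreP n x ≤
          2 * (n : ℝ) ^ 2 / (x + (2 * (n : ℝ) - 1) * Real.sqrt (x ^ 2 - 1)) := by
  rw [bernsteinSqSum_eq_eval,
    Polynomial.convexOn_Icc_iff_eval_derivative_derivative_nonneg _ zero_lt_one]
  constructor
  · intro h x hx
    obtain ⟨s, hs, hs1, rfl⟩ := exists_eq_half_add_inv hx
    exact (legendre_bound_iff n hs hs1).mpr (h _ ⟨by linarith, by linarith⟩)
  · intro h
    have hIco : ∀ t ∈ Set.Ico (0 : ℝ) (1 / 2),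
        0 ≤ (bernsteinSqSumPoly n).derivative.derivative.eval t := by
      rintro t ⟨ht0, ht1⟩
      have hs : 0 < 1 - 2 * t := by linarith
      have hs1 : 1 - 2 * t ≤ 1 := by linarith
      have := (legendre_bound_iff n hs hs1).mp (h _ (one_le_half_add_inv hs))
      rwa [show (1 - (1 - 2 * t)) / 2 = t by ring] at this
    have hIcc : ∀ t ∈ Set.Icc (0 : ℝ) (1 / 2),
        0 ≤ (bernsteinSqSumPoly n).derivative.derivative.eval t := by
      rw [← closure_Ico (by norm_num : (0 : ℝ) ≠ 1 / 2)]
      exact closure_minimal hIco (isClosed_Ici.preimage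
        (bernsteinSqSumPoly n).derivative.derivative.continuous)
    rintro t ⟨ht0, ht1⟩
    rcases le_total t (1 / 2) with ht | ht
    · exact hIcc t ⟨ht0, ht⟩
    · rw [← bernsteinSqSumPoly_derivative_derivative_eval_one_sub]
      exact hIcc _ ⟨by linarith, by linarith⟩
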